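/- Suppose ρ(F_{ℓ,α,θ}) = p/q with p a nonnegative integer, q a positive EVEN integer, and gcd(p,q) = 1. Then F_{ℓ,α,θ}^q(x) = x + p for every x ∈ ℝ (that is, every point of the circle is periodic with period q), and moreover the break points a₀ and a₁ lie on the same orbit of the circle map: there exist integers n ≥ 1 and k with F_{ℓ,α,θ}ⁿ(a₀) = a₁ + k. -/

import Mathlib

open Real Filter Set

/-- Rotation number of a lift `T` of a circle homeomorphism,
defined as the limit of `T^[n] 0 / n` (which exists and is independent
of the base point for lifts of orientation-preserving circle homeos). -/
noncomputable def rotationNumber (T : ℝ → ℝ) : ℝ :=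
  limUnder atTop (fun n : ℕ => T^[n] 0 / (n : ℝ))

/-- The expansion factor `Λ = sin(θ+α)/sin(θ−α)`. -/
noncomputable def Lam (α θ : ℝ) : ℝ := Real.sin (θ + α) / Real.sin (θ - α)

/-- The break point of increase `a₀ = (tan θ − 2ℓ)/(2 tan θ)`. -/
noncomputable def brk0 (ℓ θ : ℝ) : ℝ := (Real.tan θ - 2 * ℓ) / (2 * Real.tan θ)

/-- The break point of decrease `a₁ = −(2ℓ + tan α)/(2 tan θ)`. -/
noncomputable def brk1 (ℓ α θ : ℝ) : ℝ := -(2 * ℓ + Real.tan α) / (2 * Real.tan θ)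

/-- The two-piece definition of the lift on the fundamental interval `[a₁, a₁+1)`. -/
noncomputable def Ftrap0 (ℓ α θ x : ℝ) : ℝ :=
  if x ≤ brk0 ℓ θ then -brk1 ℓ α θ + (Lam α θ)⁻¹ * (x - brk1 ℓ α θ)
  else 1 - brk0 ℓ θ + Lam α θ * (x - brk0 ℓ θ)

/-- The lift `F_{ℓ,α,θ} : ℝ → ℝ` of the Poincaré map of the internal-wave
billiard in a rectangular trapezoid: it is given by the two-piece formula on
`[a₁, a₁+1)` and extended by `F(x+k) = F(x)+k` for `k ∈ ℤ`. -/
noncomputable def Ftrap (ℓ α θ x : ℝ) : ℝ :=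
  Ftrap0 ℓ α θ (x - ⌊x - brk1 ℓ α θ⌋) + ⌊x - brk1 ℓ α θ⌋

/-- The sum of `⌊y - c⌋` over the first `n` points `y` of the orbit of `x`; its increment between two
points counts the break points `c + ℤ` crossed by the orbit of the interval between them. -/
noncomputable def breakCount (f : CircleDeg1Lift) (c : ℝ) (n : ℕ) (x : ℝ) : ℤ :=
  ∑ j ∈ Finset.range n, ⌊(f ^ j) x - c⌋

section RightDerivative

variable {g g' : ℝ → ℝ} {x y C : ℝ}

theorem exists_right_deriv_gt (hg : Continuous g)
    (hd : ∀ z, HasDerivWithinAt g (g' z) (Ici z) z) (hxy : x < y) (h : C * (y - x) < g y - g x) :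
    ∃ z ∈ Ico x y, C < g' z := by
  by_contra! hC
  have hB : ∀ z, HasDerivAt (fun t => g x + C * (t - x)) C z := fun z => by
    simpa using (((hasDerivAt_id z).sub_const x).const_mul C).const_add (g x)
  have := image_le_of_deriv_right_le_deriv_boundary hg.continuousOn (fun z _ => hd z)
    (B := fun t => g x + C * (t - x)) (B' := fun _ => C) (by simp)
    (by fun_prop) (fun z _ => (hB z).hasDerivWithinAt) hC (right_mem_Icc.2 hxy.le)
  linarith

theorem exists_right_deriv_lt (hg : Continuous g)
    (hd : ∀ z, HasDerivWithinAt g (g' z) (Ici z) z) (hxy : x < y) (h : g y - g x < C * (y - x)) :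
    ∃ z ∈ Ico x y, g' z < C := by
  obtain ⟨z, hz, hlt⟩ := exists_right_deriv_gt (g := -g) (g' := -g') (C := -C) hg.neg
    (fun z => (hd z).neg) hxy (by simp only [Pi.neg_apply]; linarith)
  exact ⟨z, hz, by simpa using hlt⟩

theorem monotone_of_right_deriv_pos (hg : Continuous g)
    (hd : ∀ z, HasDerivWithinAt g (g' z) (Ici z) z) (hpos : ∀ z, 0 < g' z) : Monotone g := by
  intro x y hxy
  by_contra! hlt
  obtain rfl | hxy := hxy.eq_or_lt
  · exact hlt.false
  obtain ⟨z, -, hz⟩ := exists_right_deriv_lt (C := 0) hg hd hxy (by linarith)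
  exact (hpos z).not_gt hz

theorem strictMono_of_right_deriv_pos (hg : Continuous g)
    (hd : ∀ z, HasDerivWithinAt g (g' z) (Ici z) z) (hpos : ∀ z, 0 < g' z) : StrictMono g := by
  have hm := monotone_of_right_deriv_pos hg hd hpos
  intro x y hxy
  refine (hm hxy.le).lt_of_ne fun heq => (hpos x).ne' ?_
  refine UniqueDiffWithinAt.eq_deriv _ (uniqueDiffOn_Ici x x self_mem_Ici) (hd x) ?_
  refine (hasDerivWithinAt_const x (Ici x) (g x)).congr_of_eventuallyEq ?_ rfl
  filter_upwards [Icc_mem_nhdsGE hxy] with z hz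
  exact le_antisymm (heq ▸ hm hz.2) (hm hz.1)

end RightDerivative

namespace CircleDeg1Lift

open scoped Topology

variable {f : CircleDeg1Lift} {p : ℤ} {q : ℕ} {u v : ℝ}

theorem strictMono_pow (hf : StrictMono f) (n : ℕ) : StrictMono (f ^ n : CircleDeg1Lift) := by
  rw [coe_pow]
  exact hf.iterate n

theorem pow_add_apply (m n : ℕ) (x : ℝ) : (f ^ (m + n)) x = (f ^ m) ((f ^ n) x) := by
  rw [pow_add, mul_apply]

theorem pow_periodic_iff (hf : StrictMono f) (i : ℕ) (x : ℝ) :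
    (f ^ q) ((f ^ i) x) = (f ^ i) x + p ↔ (f ^ q) x = x + p := by
  rw [← pow_add_apply, add_comm, pow_add_apply, ← map_add_int,
    (strictMono_pow hf i).injective.eq_iff]

/-- The images of a gap between consecutive periodic points do not overlap modulo `ℤ` during one
period. -/
theorem gap_disjoint (hf : StrictMono f) (hc : Continuous f) (hq : 0 < q)
    (hpq : IsCoprime p (q : ℤ)) (hu : (f ^ q) u = u + p)
    (hgap : ∀ z ∈ Ioo u v, (f ^ q) z ≠ z + p) {c : ℝ} {i j : ℕ} {k l : ℤ} (hi : i < q) (hj : j < q)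
    (hk : c + k ∈ Ioo ((f ^ i) u) ((f ^ i) v)) (hl : c + l ∈ Ioo ((f ^ j) u) ((f ^ j) v)) :
    i = j ∧ k = l := by
  have le_of {i j : ℕ} {k l : ℤ} (hk : c + k ∈ Ioo ((f ^ i) u) ((f ^ i) v))
      (hl : c + l ∈ Ioo ((f ^ j) u) ((f ^ j) v)) : (f ^ j) u - l ≤ (f ^ i) u - k := by
    by_contra! hlt
    obtain ⟨z, hz⟩ := (f ^ i).continuous_iff_surjective.1 (f.continuous_pow hc i)
      ((f ^ j) u + (k - l : ℤ))
    push_cast at hz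
    refine hgap z ⟨(strictMono_pow hf i).lt_iff_lt.1 ?_, (strictMono_pow hf i).lt_iff_lt.1 ?_⟩ ?_
    · linarith
    · linarith [hk.2, hl.1]
    · rw [← pow_periodic_iff hf i, hz, ← Int.cast_sub, map_add_int, (pow_periodic_iff hf j u).2 hu]
      ring
  have key {i j : ℕ} {k l : ℤ} (hj : j < q) (hij : i ≤ j)
      (hk : c + k ∈ Ioo ((f ^ i) u) ((f ^ i) v))
      (hl : c + l ∈ Ioo ((f ^ j) u) ((f ^ j) v)) : i = j ∧ k = l := by
    have heq := le_antisymm (le_of hk hl) (le_of hl hk)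
    obtain ⟨d, rfl⟩ := Nat.exists_eq_add_of_le' hij
    obtain rfl | hd := d.eq_zero_or_pos
    · rw [zero_add] at heq ⊢
      exact ⟨rfl, by exact_mod_cast (sub_right_injective heq).symm⟩
    exfalso
    have hper : (f ^ d) ((f ^ i) u) = (f ^ i) u + (l - k : ℤ) := by
      rw [← pow_add_apply]
      push_cast
      linarith
    have h1 := f.translationNumber_of_map_pow_eq_add_int hper hd
    rw [f.translationNumber_of_map_pow_eq_add_int hu hq, div_eq_div_iff (by positivity)
      (by positivity)] at h1
    have h2 : p * d = (l - k) * q := by exact_mod_cast h1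
    have h3 : (q : ℤ) ∣ d := hpq.symm.dvd_of_dvd_mul_left (h2 ▸ dvd_mul_left _ _)
    have := Nat.le_of_dvd hd (Int.natCast_dvd_natCast.1 h3)
    omega
  rcases le_total i j with h | h
  · exact key hj h hk hl
  · exact (key hi h hl hk).imp Eq.symm Eq.symm

theorem breakCount_mono (f : CircleDeg1Lift) (c : ℝ) (n : ℕ) : Monotone (breakCount f c n) :=
  fun _ _ hxy => Finset.sum_le_sum fun j _ =>
    Int.floor_le_floor (sub_le_sub_right ((f ^ j).monotone hxy) c)

theorem breakCount_le_add_one (hf : StrictMono f) (hc : Continuous f) (hq : 0 < q)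
    (hpq : IsCoprime p (q : ℤ)) (hu : (f ^ q) u = u + p)
    (hgap : ∀ z ∈ Ioo u v, (f ^ q) z ≠ z + p) (c : ℝ) {x y : ℝ} (hx : x ∈ Ico u v)
    (hy : y ∈ Ico u v) : breakCount f c q y ≤ breakCount f c q x + 1 := by
  have mem_gap {j : ℕ} {k : ℤ} (h1 : ⌊(f ^ j) x - c⌋ < k) (h2 : k ≤ ⌊(f ^ j) y - c⌋) :
      c + k ∈ Ioo ((f ^ j) u) ((f ^ j) v) := by
    rw [Int.floor_lt] at h1
    rw [Int.le_floor] at h2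
    exact ⟨by linarith [(f ^ j).monotone hx.1], by linarith [strictMono_pow hf j hy.2]⟩
  by_cases h : ∃ i < q, ⌊(f ^ i) x - c⌋ < ⌊(f ^ i) y - c⌋
  · obtain ⟨i, hi, hlt⟩ := h
    have hle : ∀ j ∈ Finset.range q,
        ⌊(f ^ j) y - c⌋ ≤ ⌊(f ^ j) x - c⌋ + if i = j then 1 else 0 := by
      intro j hj
      rw [Finset.mem_range] at hj
      by_contra! hlt'
      split_ifs at hlt' with hij
      · subst hij
        have := (gap_disjoint hf hc hq hpq hu hgap hi hi (mem_gap hlt le_rfl)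
          (mem_gap (k := ⌊(f ^ i) y - c⌋ - 1) (by omega) (by omega))).2
        omega
      · exact hij (gap_disjoint hf hc hq hpq hu hgap hi hj (mem_gap hlt le_rfl)
          (mem_gap (by omega) le_rfl)).1
    refine (Finset.sum_le_sum hle).trans_eq ?_
    rw [Finset.sum_add_distrib, Finset.sum_ite_eq, if_pos (Finset.mem_range.2 hi), breakCount]
  · push Not at h
    have : breakCount f c q y ≤ breakCount f c q x :=
      Finset.sum_le_sum fun j hj => h j (Finset.mem_range.1 hj)
    omega

theorem hasDerivWithinAt_pow {L a b : ℝ} (hL : 0 < L)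
    (hd : ∀ x, HasDerivWithinAt f (L ^ (2 * (⌊x - a⌋ - ⌊x - b⌋) + 1)) (Ici x) x) (n : ℕ) (x : ℝ) :
    HasDerivWithinAt (f ^ n : CircleDeg1Lift)
      (L ^ (2 * (breakCount f a n x - breakCount f b n x) + n)) (Ici x) x := by
  induction n with
  | zero => simpa [breakCount] using hasDerivWithinAt_id x (Ici x)
  | succ n ih =>
    rw [pow_succ', coe_mul]
    refine ((hd ((f ^ n) x)).comp x ih fun y hy => (f ^ n).monotone hy).congr_deriv ?_
    rw [← zpow_add₀ hL.ne']
    congr 1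
    simp only [breakCount, Finset.sum_range_succ]
    push_cast
    ring

/-- Every point outside the closed set of periodic points lies in a gap between two periodic
points. -/
theorem exists_gap (hc : Continuous f) {x₀ w : ℝ} (hx₀ : (f ^ q) x₀ = x₀ + p)
    (hw : (f ^ q) w ≠ w + p) :
    ∃ u v, u < w ∧ w < v ∧ (f ^ q) u = u + p ∧ (f ^ q) v = v + p ∧
      ∀ z ∈ Ioo u v, (f ^ q) z ≠ z + p := by
  set K : Set ℝ := {z | (f ^ q) z = z + p} with hK
  have hKc : IsClosed K := isClosed_eq (f.continuous_pow hc q) (by fun_prop)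
  have htr (k : ℤ) : x₀ + k ∈ K := by
    simp only [hK, mem_ofPred_eq, map_add_int, hx₀]
    ring
  have hlo : (K ∩ Iic w).Nonempty := ⟨x₀ + ⌊w - x₀⌋, htr _, by
    have := Int.floor_le (w - x₀)
    simp only [mem_Iic]
    linarith⟩
  have hhi : (K ∩ Ici w).Nonempty := ⟨x₀ + ⌈w - x₀⌉, htr _, by
    have := Int.le_ceil (w - x₀)
    simp only [mem_Ici]
    linarith⟩
  have hba : BddAbove (K ∩ Iic w) := ⟨w, fun z hz => hz.2⟩
  have hbb : BddBelow (K ∩ Ici w) := ⟨w, fun z hz => hz.2⟩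
  have hu := (hKc.inter isClosed_Iic).csSup_mem hlo hba
  have hv := (hKc.inter isClosed_Ici).csInf_mem hhi hbb
  refine ⟨_, _, lt_of_le_of_ne hu.2 fun h => hw (h ▸ hu.1), lt_of_le_of_ne hv.2 fun h => hw ?_,
    hu.1, hv.1, fun z hz hzK => ?_⟩
  · have := hv.1
    rwa [← h] at this
  · rcases le_total z w with h | h
    · exact hz.1.not_ge (le_csSup hba ⟨hzK, h⟩)
    · exact hz.2.not_ge (csInf_le hbb ⟨hzK, h⟩)

/-- A circle homeomorphism that is piecewise linear with slopes `L` and `L⁻¹` and two break points,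
and whose rotation number has even denominator `q`, is periodic of period `q`. -/
theorem pow_eq_add_of_even {L a b : ℝ} (hL : 1 < L) (hc : Continuous f)
    (hd : ∀ x, HasDerivWithinAt f (L ^ (2 * (⌊x - a⌋ - ⌊x - b⌋) + 1)) (Ici x) x) (hq : 0 < q)
    (heven : Even q) (hpq : IsCoprime p (q : ℤ)) (hτ : translationNumber f = p / q) (w : ℝ) :
    (f ^ q) w = w + p := by
  have hL0 : 0 < L := one_pos.trans hL
  have hf : StrictMono f := strictMono_of_right_deriv_pos hc hd fun z => zpow_pos hL0 _
  have hd' := hasDerivWithinAt_pow hL0 hd q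
  have hc' := f.continuous_pow hc q
  obtain ⟨x₀, hx₀⟩ := (f.translationNumber_eq_rat_iff hc hq).1 hτ
  by_contra hw
  obtain ⟨u, v, huw, hwv, hu, hv, hgap⟩ := exists_gap hc hx₀ hw
  obtain ⟨r, hr⟩ := heven
  have hcount (c : ℝ) {x y : ℝ} (hx : x ∈ Ico u w) (hy : y ∈ Ico w v) :
      0 ≤ breakCount f c q y - breakCount f c q x ∧
        breakCount f c q y - breakCount f c q x ≤ 1 := by
    have h1 := breakCount_mono f c q (hx.2.le.trans hy.1)
    have h2 := breakCount_le_add_one hf hc hq hpq hu hgap c ⟨hx.1, hx.2.trans hwv⟩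
      ⟨huw.le.trans hy.1, hy.2⟩
    omega
  rcases lt_or_gt_of_ne hw with h | h
  · obtain ⟨x, hx, hx1⟩ := exists_right_deriv_lt (C := 1) hc' hd' huw (by linarith)
    obtain ⟨y, hy, hy1⟩ := exists_right_deriv_gt (C := 1) hc' hd' hwv (by linarith)
    rw [zpow_lt_one_iff_right₀ hL] at hx1
    rw [one_lt_zpow_iff_right₀ hL] at hy1
    have h1 := hcount a hx hy
    have h2 := hcount b hx hy
    omega
  · obtain ⟨x, hx, hx1⟩ := exists_right_deriv_gt (C := 1) hc' hd' huw (by linarith)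
    obtain ⟨y, hy, hy1⟩ := exists_right_deriv_lt (C := 1) hc' hd' hwv (by linarith)
    rw [one_lt_zpow_iff_right₀ hL] at hx1
    rw [zpow_lt_one_iff_right₀ hL] at hy1
    have h1 := hcount a hx hy
    have h2 := hcount b hx hy
    omega

/-- If some power of a circle homeomorphism with two break points `a` and `b` of opposite type is a
translation, then the orbit of `a` passes through `b`. -/
theorem exists_pow_eq_add_of_periodic {L a b : ℝ} (hL : 1 < L) (hc : Continuous f)
    (hd : ∀ x, HasDerivWithinAt f (L ^ (2 * (⌊x - a⌋ - ⌊x - b⌋) + 1)) (Ici x) x) (hq : 0 < q)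
    (hper : ∀ x, (f ^ q) x = x + p) : ∃ n : ℕ, ∃ k : ℤ, 1 ≤ n ∧ (f ^ n) a = b + k := by
  have hL0 : 0 < L := one_pos.trans hL
  have hexp (x : ℝ) : 2 * (breakCount f a q x - breakCount f b q x) + q = 0 := by
    have h1 := UniqueDiffWithinAt.eq_deriv _ (uniqueDiffOn_Ici x x self_mem_Ici) (hasDerivWithinAt_pow hL0 hd q x)
      (((hasDerivWithinAt_id x (Ici x)).add_const (p : ℝ)).congr (fun y _ => hper y) (hper x))
    exact (zpow_eq_one_iff_right₀ hL0.le hL.ne').1 h1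
  by_contra! hne
  have hnear (j : ℕ) : ∀ᶠ x in 𝓝[<] a, ⌊(f ^ j) a - b⌋ ≤ ⌊(f ^ j) x - b⌋ := by
    have hlt : (⌊(f ^ j) a - b⌋ : ℝ) < (f ^ j) a - b := by
      refine (Int.floor_le _).lt_of_ne fun h => hne (q + j) (⌊(f ^ j) a - b⌋ + p) (by omega) ?_
      rw [pow_add_apply, hper]
      push_cast
      linarith
    have hcont : Continuous fun x => (f ^ j) x - b := (f.continuous_pow hc j).sub continuous_const
    filter_upwards [nhdsWithin_le_nhds (hcont.continuousAt.eventually_const_lt hlt)] with x hx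
    exact Int.le_floor.2 hx.le
  have hall : ∀ᶠ x in 𝓝[<] a, ∀ j ∈ Finset.range q, ⌊(f ^ j) a - b⌋ ≤ ⌊(f ^ j) x - b⌋ :=
    (Finset.eventually_all _).2 fun j _ => hnear j
  obtain ⟨x, hx, hxa⟩ := (hall.and self_mem_nhdsWithin).exists
  have hb : breakCount f b q a ≤ breakCount f b q x := Finset.sum_le_sum hx
  have ha : breakCount f a q x < breakCount f a q a := by
    refine Finset.sum_lt_sum (fun j _ => Int.floor_le_floor
      (sub_le_sub_right ((f ^ j).monotone (le_of_lt hxa)) a)) ⟨0, Finset.mem_range.2 hq, ?_⟩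
    simpa [Int.floor_lt] using hxa
  have h1 := hexp x
  have h2 := hexp a
  omega

end CircleDeg1Lift

section Trapezoid

variable {ℓ α θ : ℝ}

theorem one_lt_Lam (hα : 0 < α) (hαθ : α < θ) (hθ : θ < π / 2) : 1 < Lam α θ := by
  have h1 : 0 < Real.sin (θ - α) := Real.sin_pos_of_pos_of_lt_pi (by linarith) (by linarith)
  rw [Lam, one_lt_div h1, Real.sin_add, Real.sin_sub]
  have h2 := Real.cos_pos_of_mem_Ioo (x := θ) ⟨by linarith, hθ⟩
  have h3 := Real.sin_pos_of_pos_of_lt_pi (x := α) hα (by linarith)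
  nlinarith [mul_pos h2 h3]

theorem brk0_sub_brk1 (ht : 0 < Real.tan θ) :
    brk0 ℓ θ - brk1 ℓ α θ = (Real.tan θ + Real.tan α) / (2 * Real.tan θ) := by
  rw [brk0, brk1]
  field_simp
  ring

theorem brk1_lt_brk0 (hα : 0 < α) (hαθ : α < θ) (hθ : θ < π / 2) : brk1 ℓ α θ < brk0 ℓ θ := by
  have h1 := Real.tan_pos_of_pos_of_lt_pi_div_two hα (hαθ.trans hθ)
  have h2 := Real.tan_pos_of_pos_of_lt_pi_div_two (hα.trans hαθ) hθ
  rw [← sub_pos, brk0_sub_brk1 h2]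
  positivity

theorem brk0_lt_brk1_add_one (hα : 0 < α) (hαθ : α < θ) (hθ : θ < π / 2) :
    brk0 ℓ θ < brk1 ℓ α θ + 1 := by
  have h1 := Real.tan_lt_tan_of_lt_of_lt_pi_div_two (by linarith) hθ hαθ
  have h2 := Real.tan_pos_of_pos_of_lt_pi_div_two (hα.trans hαθ) hθ
  rw [← sub_lt_iff_lt_add', brk0_sub_brk1 h2, div_lt_one (by positivity)]
  linarith

theorem Lam_mul_one_sub (hα : 0 < α) (hαθ : α < θ) (hθ : θ < π / 2) :
    Lam α θ * (1 - (brk0 ℓ θ - brk1 ℓ α θ)) = brk0 ℓ θ - brk1 ℓ α θ := by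
  have ht := Real.tan_pos_of_pos_of_lt_pi_div_two (hα.trans hαθ) hθ
  have h1 : Real.sin (θ - α) ≠ 0 :=
    (Real.sin_pos_of_pos_of_lt_pi (by linarith) (by linarith)).ne'
  have h2 : Real.cos θ ≠ 0 := (Real.cos_pos_of_mem_Ioo ⟨by linarith, hθ⟩).ne'
  have h3 : Real.cos α ≠ 0 := (Real.cos_pos_of_mem_Ioo ⟨by linarith, by linarith⟩).ne'
  have hadd : Real.sin (θ + α) = (Real.tan θ + Real.tan α) * (Real.cos θ * Real.cos α) := by
    rw [Real.sin_add, Real.tan_eq_sin_div_cos, Real.tan_eq_sin_div_cos]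
    field_simp
  have hsub : Real.sin (θ - α) = (Real.tan θ - Real.tan α) * (Real.cos θ * Real.cos α) := by
    rw [Real.sin_sub, Real.tan_eq_sin_div_cos, Real.tan_eq_sin_div_cos]
    field_simp
  have hone : 1 - (Real.tan θ + Real.tan α) / (2 * Real.tan θ) =
      (Real.tan θ - Real.tan α) / (2 * Real.tan θ) := by
    field_simp
    ring
  rw [brk0_sub_brk1 ht, hone, Lam, div_mul_div_comm, div_eq_div_iff
    (mul_ne_zero h1 (by positivity)) (by positivity), hadd, hsub]
  ring

theorem Ftrap0_of_brk0_le (hα : 0 < α) (hαθ : α < θ) (hθ : θ < π / 2) {x : ℝ}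
    (hx : brk0 ℓ θ ≤ x) : Ftrap0 ℓ α θ x = 1 - brk0 ℓ θ + Lam α θ * (x - brk0 ℓ θ) := by
  rw [Ftrap0]
  split_ifs with h
  · have hL := (one_pos.trans (one_lt_Lam hα hαθ hθ)).ne'
    obtain rfl := le_antisymm h hx
    rw [← Lam_mul_one_sub hα hαθ hθ, inv_mul_cancel_left₀ hL]
    ring
  · rfl

theorem Ftrap_add_one (x : ℝ) : Ftrap ℓ α θ (x + 1) = Ftrap ℓ α θ x + 1 := by
  have h : ⌊x + 1 - brk1 ℓ α θ⌋ = ⌊x - brk1 ℓ α θ⌋ + 1 := by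
    rw [add_sub_right_comm, Int.floor_add_one]
  rw [Ftrap, Ftrap, h]
  push_cast
  rw [add_sub_add_right_eq_sub, add_assoc]

theorem continuous_Ftrap (hα : 0 < α) (hαθ : α < θ) (hθ : θ < π / 2) :
    Continuous (Ftrap ℓ α θ) := by
  have hL := (one_pos.trans (one_lt_Lam hα hαθ hθ)).ne'
  have h0 : Continuous (Ftrap0 ℓ α θ) := by
    refine Continuous.if_le (by fun_prop) (by fun_prop) continuous_id continuous_const ?_
    rintro x rfl
    rw [← Ftrap0_of_brk0_le hα hαθ hθ le_rfl, Ftrap0, if_pos le_rfl]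
  have hg : Continuous ((fun s => Ftrap0 ℓ α θ (s + brk1 ℓ α θ) - s) ∘ Int.fract) := by
    refine ContinuousOn.comp_fract'' (by fun_prop) ?_
    rw [Ftrap0, if_pos (by linarith [brk1_lt_brk0 (ℓ := ℓ) hα hαθ hθ]),
      Ftrap0_of_brk0_le hα hαθ hθ (by linarith [brk0_lt_brk1_add_one (ℓ := ℓ) hα hαθ hθ])]
    linear_combination -Lam_mul_one_sub (ℓ := ℓ) hα hαθ hθ
  have heq : Ftrap ℓ α θ = fun x => ((fun s => Ftrap0 ℓ α θ (s + brk1 ℓ α θ) - s) ∘ Int.fract)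
      (x - brk1 ℓ α θ) + (x - brk1 ℓ α θ) := by
    funext x
    simp only [Function.comp_apply, Ftrap, Int.fract]
    rw [sub_right_comm, sub_add_cancel]
    ring
  rw [heq]
  exact (hg.comp (continuous_sub_right _)).add (continuous_sub_right _)

theorem hasDerivWithinAt_Ftrap (hα : 0 < α) (hαθ : α < θ) (hθ : θ < π / 2) (x : ℝ) :
    HasDerivWithinAt (Ftrap ℓ α θ)
      (Lam α θ ^ (2 * (⌊x - brk0 ℓ θ⌋ - ⌊x - brk1 ℓ α θ⌋) + 1)) (Ici x) x := by
  have hba := brk1_lt_brk0 (ℓ := ℓ) hα hαθ hθ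
  have hab := brk0_lt_brk1_add_one (ℓ := ℓ) hα hαθ hθ
  set n := ⌊x - brk1 ℓ α θ⌋ with hn
  have hn1 := Int.floor_le (x - brk1 ℓ α θ)
  have hn2 := Int.lt_floor_add_one (x - brk1 ℓ α θ)
  rw [← hn] at hn1 hn2
  have hF {z : ℝ} (hxz : x ≤ z) (hz : z < brk1 ℓ α θ + n + 1) :
      Ftrap ℓ α θ z = Ftrap0 ℓ α θ (z - n) + n := by
    have : ⌊z - brk1 ℓ α θ⌋ = n := Int.floor_eq_iff.2 ⟨by linarith, by linarith⟩
    rw [Ftrap, this]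
  rcases lt_or_ge x (brk0 ℓ θ + n) with hx | hx
  · have hfl : ⌊x - brk0 ℓ θ⌋ = n - 1 :=
      Int.floor_eq_iff.2 ⟨by push_cast; linarith, by push_cast; linarith⟩
    rw [hfl, show 2 * (n - 1 - n) + 1 = -1 by ring, zpow_neg_one]
    have hlin : HasDerivWithinAt (fun z => -brk1 ℓ α θ + (Lam α θ)⁻¹ * (z - n - brk1 ℓ α θ) + n)
        (Lam α θ)⁻¹ (Ici x) x := by
      simpa using (((((hasDerivWithinAt_id x (Ici x)).sub_const (n : ℝ)).sub_const
        (brk1 ℓ α θ)).const_mul (Lam α θ)⁻¹).const_add (-brk1 ℓ α θ)).add_const (n : ℝ)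
    refine hlin.congr_of_eventuallyEq_of_mem ?_ self_mem_Ici
    filter_upwards [Ico_mem_nhdsGE hx] with z hz
    rw [hF hz.1 (by linarith [hz.2]), Ftrap0, if_pos (by linarith [hz.2])]
  · have hfl : ⌊x - brk0 ℓ θ⌋ = n := Int.floor_eq_iff.2 ⟨by linarith, by linarith⟩
    rw [hfl, sub_self, mul_zero, zero_add, zpow_one]
    have hlin : HasDerivWithinAt (fun z => 1 - brk0 ℓ θ + Lam α θ * (z - n - brk0 ℓ θ) + n)
        (Lam α θ) (Ici x) x := by
      simpa using (((((hasDerivWithinAt_id x (Ici x)).sub_const (n : ℝ)).sub_const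
        (brk0 ℓ θ)).const_mul (Lam α θ)).const_add (1 - brk0 ℓ θ)).add_const (n : ℝ)
    refine hlin.congr_of_eventuallyEq_of_mem ?_ self_mem_Ici
    have hx' : x < brk1 ℓ α θ + n + 1 := by linarith
    filter_upwards [Ico_mem_nhdsGE hx'] with z hz
    rw [hF hz.1 hz.2, Ftrap0_of_brk0_le hα hαθ hθ (by linarith [hz.1])]

/-- `Ftrap` as a bundled lift of a circle map of degree one. -/
noncomputable def trapLift (ℓ : ℝ) (hα : 0 < α) (hαθ : α < θ) (hθ : θ < π / 2) :
    CircleDeg1Lift where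
  toFun := Ftrap ℓ α θ
  monotone' := monotone_of_right_deriv_pos (continuous_Ftrap hα hαθ hθ)
    (hasDerivWithinAt_Ftrap hα hαθ hθ)
    fun _ => zpow_pos (one_pos.trans (one_lt_Lam hα hαθ hθ)) _
  map_add_one' := Ftrap_add_one

theorem CircleDeg1Lift.rotationNumber_eq (f : CircleDeg1Lift) :
    rotationNumber f = CircleDeg1Lift.translationNumber f := by
  have h := f.tendsto_translation_number₀
  simp only [CircleDeg1Lift.coe_pow] at h
  exact h.limUnder_eq

end Trapezoid

/-- if ρ(F_{ℓ,α,θ}) = p/q with q even (in lowest terms), then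
F^[q] = · + p (every point is q-periodic on the circle) and the break points
a₀, a₁ lie on the same orbit. -/
theorem stmt4 (ℓ α θ : ℝ) (hℓ : 0 < ℓ) (hα : 0 < α) (hαθ : α < θ)
    (hθ : θ < π / 2) (htan : Real.tan θ > 2 * ℓ + Real.tan α)
    (p q : ℕ) (hq : 0 < q) (heven : Even q) (hpq : Nat.Coprime p q)
    (hrot : rotationNumber (Ftrap ℓ α θ) = (p : ℝ) / (q : ℝ)) :
    (∀ x : ℝ, (Ftrap ℓ α θ)^[q] x = x + (p : ℝ)) ∧
    ∃ (n : ℕ) (k : ℤ), 1 ≤ n ∧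
      (Ftrap ℓ α θ)^[n] (brk0 ℓ θ) = brk1 ℓ α θ + (k : ℝ) := by
  set f : CircleDeg1Lift := trapLift ℓ hα hαθ hθ
  have hc : Continuous f := continuous_Ftrap hα hαθ hθ
  have hd := hasDerivWithinAt_Ftrap (ℓ := ℓ) hα hαθ hθ
  have hL := one_lt_Lam hα hαθ hθ
  have hτ : f.translationNumber = (p : ℤ) / q := by
    rw [← f.rotationNumber_eq, Int.cast_natCast]
    exact hrot
  have hper := f.pow_eq_add_of_even hL hc hd hq heven (Nat.isCoprime_iff_coprime.2 hpq) hτ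
  obtain ⟨n, k, hn, hk⟩ := f.exists_pow_eq_add_of_periodic hL hc hd hq hper
  simp only [CircleDeg1Lift.coe_pow] at hper hk
  exact ⟨fun x => by exact_mod_cast hper x, n, k, hn, hk⟩
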